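/- Each of the two stone boundary words evaluates to minus the identity matrix: (γ⁻¹·β⁻¹)²·(α⁻¹·γ)²·(β·α)² = −I and (β⁻¹·α⁻¹)²·(γ·β)²·(α·γ⁻¹)² = −I. -/

import Mathlib

open Matrix

/-- `ω = exp(2πi/12)`, a primitive 12th root of unity. -/
noncomputable def ω : ℂ := Complex.exp (2 * Real.pi * Complex.I / 12)

/-- The SL₂(ℂ) connection matrix on northeast edges. -/
noncomputable def α : Matrix (Fin 2) (Fin 2) ℂ := !![ω^7, 0; 0, ω^5]

/-- The SL₂(ℂ) connection matrix on northwest edges. -/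
noncomputable def β : Matrix (Fin 2) (Fin 2) ℂ := !![ω^7, ω^3; 0, ω^5]

/-- The SL₂(ℂ) connection matrix on horizontal edges. -/
noncomputable def γ : Matrix (Fin 2) (Fin 2) ℂ := !![ω^5, 0; ω^3, ω^7]

theorem isPrimitiveRoot_ω : IsPrimitiveRoot ω 12 := by
  simpa [ω] using Complex.isPrimitiveRoot_exp 12 (by norm_num)

/-- `ω` is a root of the 12th cyclotomic polynomial. -/
theorem ω_pow_four : ω ^ 4 = ω ^ 2 - 1 := by
  have h6 : ω ^ 6 ≠ 1 := isPrimitiveRoot_ω.pow_ne_one_of_pos_of_lt (by norm_num) (by norm_num)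
  have h4 : ω ^ 4 ≠ 1 := isPrimitiveRoot_ω.pow_ne_one_of_pos_of_lt (by norm_num) (by norm_num)
  have h : (ω ^ 6 - 1) * ((ω ^ 2 + 1) * (ω ^ 4 - ω ^ 2 + 1)) = 0 := by
    linear_combination isPrimitiveRoot_ω.pow_eq_one
  have h2 : ω ^ 2 + 1 ≠ 0 := fun h2 => h4 (by linear_combination (ω ^ 2 - 1) * h2)
  have h0 := (mul_eq_zero.1 ((mul_eq_zero.1 h).resolve_left (sub_ne_zero.2 h6))).resolve_left h2
  linear_combination h0

theorem ω_pow_five : ω ^ 5 = ω ^ 3 - ω := by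
  linear_combination ω * ω_pow_four

theorem ω_pow_seven : ω ^ 7 = -ω := by
  linear_combination (ω ^ 3 + ω) * ω_pow_four

theorem α_inv : α⁻¹ = !![ω ^ 5, 0; 0, ω ^ 7] := by
  refine Matrix.inv_eq_right_inv ?_
  simp [α, Matrix.one_fin_two, ← pow_add, isPrimitiveRoot_ω.pow_eq_one]

theorem β_inv : β⁻¹ = !![ω ^ 5, -ω ^ 3; 0, ω ^ 7] := by
  refine Matrix.inv_eq_right_inv ?_
  simp [β, Matrix.one_fin_two, ← pow_add, isPrimitiveRoot_ω.pow_eq_one]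

theorem γ_inv : γ⁻¹ = !![ω ^ 7, 0; -ω ^ 3, ω ^ 5] := by
  refine Matrix.inv_eq_right_inv ?_
  simp [γ, Matrix.one_fin_two, ← pow_add, isPrimitiveRoot_ω.pow_eq_one]

/-- Each of the two stone boundary words evaluates to minus the identity matrix. -/
theorem stone_boundary_words_eq_neg_one :
    (γ⁻¹ * β⁻¹)^2 * (α⁻¹ * γ)^2 * (β * α)^2 = -(1 : Matrix (Fin 2) (Fin 2) ℂ) ∧
    (β⁻¹ * α⁻¹)^2 * (γ * β)^2 * (α * γ⁻¹)^2 = -(1 : Matrix (Fin 2) (Fin 2) ℂ) := by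
  have h := ω_pow_four
  rw [α_inv, β_inv, γ_inv, α, β, γ, ω_pow_five, ω_pow_seven]
  constructor <;> ext i j <;> fin_cases i <;> fin_cases j <;>
    simp [pow_two (_ : Matrix _ _ ℂ)] <;> grind
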